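/- In Λ, the vectors of the form D = C + aF − b₁E₁ − ⋯ − b₆E₆, with a a non-negative integer and each b_i ∈ {0, 1}, satisfying D·D = −1, D·(C − E₁ − E₂) ≥ 0 and D·(C + F − E₃ − E₄ − E₅ − E₆) ≥ 0, are exactly the following twenty vectors: C − E_i for i ∈ {3,4,5,6}; C + F − E_i − E_j − E_k for i ∈ {1,2} and 3 ≤ j < k ≤ 6; and C + 2F − E₁ − ⋯ − E₆ + E_j for j ∈ {3,4,5,6}. In particular there are exactly 20 such vectors. -/

import Mathlib

/-- The Picard lattice of a relatively minimal conic bundle with six degenerate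
fibres: the free abelian group with basis `C, F, E₁, …, E₆`, realised as
`Fin 8 → ℤ`. -/
abbrev Lam : Type := Fin 8 → ℤ

/-- The basis vector `C`. -/
def Cv : Lam := Pi.single 0 1

/-- The basis vector `F`. -/
def Fv : Lam := Pi.single 1 1

/-- The basis vector `E_{i+1}` of the paper, for `i : Fin 6`. -/
def Ev (i : Fin 6) : Lam := Pi.single i.succ.succ 1

/-- The intersection form: `C·C = 0`, `C·F = 1`, `F·F = 0`, `E_i·E_i = −1`, and
all other products of distinct basis vectors are `0`. -/
def ip (v w : Lam) : ℤ :=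
  v 0 * w 1 + v 1 * w 0 - ∑ i : Fin 6, v i.succ.succ * w i.succ.succ

/-- The set of vectors `D = C + aF − b₁E₁ − ⋯ − b₆E₆` (with `a` a non-negative
integer and each `b_i ∈ {0, 1}`) satisfying `D·D = −1`, `D·(C − E₁ − E₂) ≥ 0`
and `D·(C + F − E₃ − E₄ − E₅ − E₆) ≥ 0`. -/
def negSections : Set Lam :=
  {D | ∃ (a : ℕ) (b : Fin 6 → ℤ), (∀ i, b i = 0 ∨ b i = 1) ∧
    D = Cv + (a : ℤ) • Fv - ∑ i, b i • Ev i ∧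
    ip D D = -1 ∧
    0 ≤ ip D (Cv - Ev 0 - Ev 1) ∧
    0 ≤ ip D (Cv + Fv - Ev 2 - Ev 3 - Ev 4 - Ev 5)}

/-- The vector `C + aF − b₁E₁ − ⋯ − b₆E₆`. -/
def sectionVec (a : ℕ) (b : Fin 6 → ℤ) : Lam :=
  Cv + (a : ℤ) • Fv - ∑ i, b i • Ev i

/-- The numerical conditions cutting out `negSections`. -/
abbrev IsNegSection (D : Lam) : Prop :=
  ip D D = -1 ∧ 0 ≤ ip D (Cv - Ev 0 - Ev 1) ∧
    0 ≤ ip D (Cv + Fv - Ev 2 - Ev 3 - Ev 4 - Ev 5)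

/-- The explicit list of vectors `C − E_i`, `C + F − E_i − E_j − E_k` and
`C + 2F − E₁ − ⋯ − E₆ + E_j`. -/
def explicitSections : Finset Lam :=
  ({2, 3, 4, 5} : Finset (Fin 6)).image (fun i => Cv - Ev i) ∪
    ((({0, 1} : Finset (Fin 6)) ×ˢ ({2, 3, 4, 5} : Finset (Fin 6)) ×ˢ
      ({2, 3, 4, 5} : Finset (Fin 6))).filter (fun p => p.2.1 < p.2.2)).image
        (fun p => Cv + Fv - Ev p.1 - Ev p.2.1 - Ev p.2.2) ∪
    ({2, 3, 4, 5} : Finset (Fin 6)).image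
      (fun j => Cv + (2 : ℤ) • Fv - ∑ i, Ev i + Ev j)

theorem card_explicitSections : explicitSections.card = 20 := by
  decide +kernel

theorem sectionVec_zero (a : ℕ) (b : Fin 6 → ℤ) : sectionVec a b 0 = 1 := by
  simp [sectionVec, Cv, Fv, Ev, Fin.sum_univ_six]

theorem sectionVec_one (a : ℕ) (b : Fin 6 → ℤ) : sectionVec a b 1 = a := by
  simp [sectionVec, Cv, Fv, Ev, Fin.sum_univ_six, Fin.ext_iff]

theorem sectionVec_succ_succ (a : ℕ) (b : Fin 6 → ℤ) (i : Fin 6) :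
    sectionVec a b i.succ.succ = -b i := by
  fin_cases i <;> simp [sectionVec, Cv, Fv, Ev, Fin.sum_univ_six, Fin.ext_iff]

theorem ip_sectionVec_self (a : ℕ) (b : Fin 6 → ℤ) :
    ip (sectionVec a b) (sectionVec a b) = 2 * a - ∑ i, b i * b i := by
  simp only [ip, sectionVec_zero, sectionVec_one, sectionVec_succ_succ, neg_mul_neg]
  ring

theorem sectionVec_mem_explicitSections :
    ∀ (a : Fin 3) (b : Fin 6 → Fin 2),
      IsNegSection (sectionVec a fun i => ((b i : ℕ) : ℤ)) →
        sectionVec a (fun i => ((b i : ℕ) : ℤ)) ∈ explicitSections := by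
  decide +kernel

theorem exists_sectionVec_of_mem_explicitSections :
    ∀ D ∈ explicitSections, IsNegSection D ∧
      ∃ (a : Fin 3) (b : Fin 6 → Fin 2), D = sectionVec a fun i => ((b i : ℕ) : ℤ) := by
  decide +kernel

theorem negSections_eq_coe_explicitSections :
    negSections = (explicitSections : Set Lam) := by
  ext D
  constructor
  · rintro ⟨a, b, hb, hD, h⟩
    change D = sectionVec a b at hD
    subst hD
    have ha : a < 3 := by
      have hsq : ∑ i, b i * b i ≤ ∑ _i : Fin 6, (1 : ℤ) :=
        Finset.sum_le_sum fun i _ => by rcases hb i with h | h <;> simp [h]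
      have hself := h.1
      rw [ip_sectionVec_self] at hself
      simp at hsq
      omega
    obtain ⟨c, rfl⟩ : ∃ c : Fin 6 → Fin 2, b = fun i => ((c i : ℕ) : ℤ) := by
      have hc : ∀ i, ∃ x : Fin 2, b i = ((x : ℕ) : ℤ) := fun i =>
        (hb i).elim (fun h => ⟨0, h⟩) fun h => ⟨1, h⟩
      choose c hc using hc
      exact ⟨c, funext hc⟩
    exact sectionVec_mem_explicitSections ⟨a, ha⟩ c h
  · intro hD
    obtain ⟨h, a, b, rfl⟩ := exists_sectionVec_of_mem_explicitSections D hD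
    refine ⟨a, fun i => ((b i : ℕ) : ℤ), fun i => ?_, rfl, h⟩
    have := (b i).isLt
    dsimp only
    omega

/-- `negSections` consists exactly of the twenty vectors `C − E_i` for
`i ∈ {3,4,5,6}`; `C + F − E_i − E_j − E_k` for `i ∈ {1,2}`, `3 ≤ j < k ≤ 6`; and
`C + 2F − E₁ − ⋯ − E₆ + E_j` for `j ∈ {3,4,5,6}` (here indexed by `Fin 6`, so
the index sets `{3,4,5,6}` and `{1,2}` become `{2,3,4,5}` and `{0,1}`); in
particular there are exactly `20` such vectors. -/
theorem negSections_eq_twenty :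
    negSections =
      {D | (∃ i ∈ ({2, 3, 4, 5} : Set (Fin 6)), D = Cv - Ev i) ∨
        (∃ i ∈ ({0, 1} : Set (Fin 6)), ∃ j ∈ ({2, 3, 4, 5} : Set (Fin 6)),
          ∃ k ∈ ({2, 3, 4, 5} : Set (Fin 6)), j < k ∧
            D = Cv + Fv - Ev i - Ev j - Ev k) ∨
        (∃ j ∈ ({2, 3, 4, 5} : Set (Fin 6)),
          D = Cv + (2 : ℤ) • Fv - ∑ i, Ev i + Ev j)} ∧
    negSections.ncard = 20 := by
  refine ⟨?_, by
    rw [negSections_eq_coe_explicitSections, Set.ncard_coe_finset, card_explicitSections]⟩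
  rw [negSections_eq_coe_explicitSections]
  ext D
  simp only [explicitSections, Finset.coe_union, Finset.coe_image, Set.mem_union, Set.mem_image,
    Finset.mem_coe, Finset.mem_filter, Finset.mem_product, Prod.exists, Set.mem_ofPred_eq,
    Finset.mem_insert, Finset.mem_singleton, Set.mem_insert_iff, Set.mem_singleton_iff,
    or_assoc, eq_comm (a := D)]
  refine or_congr Iff.rfl (or_congr ?_ Iff.rfl)
  constructor
  · rintro ⟨i, j, k, ⟨⟨hi, hj, hk⟩, hjk⟩, h⟩
    exact ⟨i, hi, j, hj, k, hk, hjk, h⟩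
  · rintro ⟨i, hi, j, hj, k, hk, hjk, h⟩
    exact ⟨i, j, k, ⟨⟨hi, hj, hk⟩, hjk⟩, h⟩
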